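/- arXiv:1009.3640 — 2 statements merged into one kernel-verified Lean document; each statement's English description precedes it below -/
import Mathlib

section
/- Let $R, \delta > 0$ and let $Z_1,\dots,Z_k$ be non-negative random variables with $k \leq 1/(320 R \delta^2)$, such that almost surely, for each $i$, $\mathbb{E}[Z_i \mid Z_1,\dots,Z_{i-1}] \leq 1 + 1/(20k)$ and $\Pr[|Z_i - 1| \geq t \mid Z_1,\dots,Z_{i-1}] \leq R e^{-t/\delta}$ for all $t \geq 0$. Then $\Pr[\prod_{i=1}^k Z_i \geq 1.1] \leq \exp(-1/(80\delta) + Rk/2)$ if $k < 1/(80R\delta)$, and $\Pr[\prod_{i=1}^k Z_i \geq 1.1] \leq \exp(-1/(12800 R k \delta^2))$ otherwise. -/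
open MeasureTheory Finset

/-- The σ-algebra generated by `Z 0, …, Z (i-1)`. -/
def pastSigma {Ω : Type*} [MeasurableSpace Ω] (Z : ℕ → Ω → ℝ) (i : ℕ) : MeasurableSpace Ω :=
  MeasurableSpace.comap (fun ω => fun j : Fin i => Z j ω) inferInstance

lemma lintegral_mul_ofReal_le_of_condExp_le {Ω : Type*} {m m₀ : MeasurableSpace Ω}
    {μ : Measure Ω} [IsFiniteMeasure μ] (hm : m ≤ m₀) {f : Ω → ℝ} (hf : Integrable f μ)
    (hfm : Measurable f) (hf0 : ∀ ω, 0 ≤ f ω) {c : ℝ} (hc : 0 ≤ c)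
    (h : ∀ᵐ ω ∂μ, (μ[f | m]) ω ≤ c) {W : Ω → ENNReal} (hW : Measurable[m] W) :
    ∫⁻ ω, W ω * ENNReal.ofReal (f ω) ∂μ ≤ ENNReal.ofReal c * ∫⁻ ω, W ω ∂μ := by
  have hle : (μ.withDensity fun ω => ENNReal.ofReal (f ω)).trim hm
      ≤ ENNReal.ofReal c • μ.trim hm := by
    refine Measure.le_iff.2 fun s hs => ?_
    rw [trim_measurableSet_eq hm hs, withDensity_apply _ (hm s hs), Measure.smul_apply,
      trim_measurableSet_eq hm hs, ← ofReal_integral_eq_lintegral_ofReal hf.integrableOn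
        (ae_of_all _ hf0), ← setIntegral_condExp hm hf hs, smul_eq_mul]
    calc ENNReal.ofReal (∫ ω in s, (μ[f | m]) ω ∂μ)
        ≤ ENNReal.ofReal (∫ _ in s, c ∂μ) :=
          ENNReal.ofReal_le_ofReal (integral_mono_ae integrable_condExp.integrableOn
            (integrable_const c) (ae_restrict_of_ae h))
      _ = ENNReal.ofReal c * μ s := by
          rw [setIntegral_const, smul_eq_mul, mul_comm, ENNReal.ofReal_mul hc,
            ofReal_measureReal]
  calc ∫⁻ ω, W ω * ENNReal.ofReal (f ω) ∂μ
      = ∫⁻ ω, W ω ∂(μ.withDensity fun ω => ENNReal.ofReal (f ω)).trim hm := by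
        rw [lintegral_trim hm hW, lintegral_withDensity_eq_lintegral_mul _
          hfm.ennreal_ofReal (hW.mono hm le_rfl)]
        simp [mul_comm]
    _ ≤ ∫⁻ ω, W ω ∂(ENNReal.ofReal c • μ.trim hm) := lintegral_mono' hle le_rfl
    _ = _ := by rw [lintegral_smul_measure, lintegral_trim hm hW, smul_eq_mul]

lemma exp_sub_one_sub_le_abs (y : ℝ) :
    Real.exp y - 1 - y ≤ Real.exp |y| - 1 - |y| := by
  rcases le_total 0 y with hy | hy
  · rw [abs_of_nonneg hy]
  · rw [abs_of_nonpos hy]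
    have h := Real.sinh_le_self_iff.2 hy
    rw [Real.sinh_eq] at h
    linarith

lemma lintegral_exp_sub_one_sub_le_of_tail {Ω : Type*} [MeasurableSpace Ω] {ν : Measure Ω}
    {f : Ω → ℝ} (hf : Measurable f) (hf0 : ∀ ω, 0 ≤ f ω) {R δ l : ℝ} (hR : 0 ≤ R)
    (hδ : 0 < δ) (hl : 0 ≤ l) (hlδ : l * δ ≤ 1 / 2)
    (htail : ∀ t, 0 ≤ t → ν {ω | t ≤ f ω} ≤ ENNReal.ofReal (R * Real.exp (-t / δ)) * ν Set.univ) :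
    ∫⁻ ω, ENNReal.ofReal (Real.exp (l * f ω) - 1 - l * f ω) ∂ν
      ≤ ENNReal.ofReal (2 * R * (l * δ) ^ 2) * ν Set.univ := by
  have hcont : Continuous fun t : ℝ => l * (Real.exp (l * t) - 1) := by fun_prop
  have hg0 : ∀ t : ℝ, 0 ≤ t → 0 ≤ l * (Real.exp (l * t) - 1) := fun t ht =>
    mul_nonneg hl (sub_nonneg.2 (Real.one_le_exp (mul_nonneg hl ht)))
  have hprim : ∀ x : ℝ, ∫ t in (0 : ℝ)..x, l * (Real.exp (l * t) - 1)
      = Real.exp (l * x) - 1 - l * x := fun x => by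
    rw [intervalIntegral.integral_eq_sub_of_hasDerivAt
      (f := fun t => Real.exp (l * t) - 1 - l * t) (fun t _ => ?_)
      (hcont.intervalIntegrable _ _)]
    · simp
    · have h : HasDerivAt (fun y => l * y) l t := by
        simpa using (hasDerivAt_id t).const_mul l
      exact ((h.exp.sub_const 1).sub h).congr_deriv (by ring)
  have hlc := lintegral_comp_eq_lintegral_meas_le_mul ν (ae_of_all _ hf0) hf.aemeasurable
    (fun t _ => hcont.intervalIntegrable 0 t)
    ((ae_restrict_mem measurableSet_Ioi).mono fun t ht => hg0 t (le_of_lt ht))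
  simp only [hprim] at hlc
  have hneg : -1 / δ < 0 := div_neg_of_neg_of_pos (by norm_num) hδ
  have hneg' : l - 1 / δ < 0 := by
    rw [sub_neg, lt_div_iff₀ hδ]; linarith
  have hint₁ := (integrableOn_exp_mul_Ioi hneg' 0).const_mul (R * l)
  have hint₂ := (integrableOn_exp_mul_Ioi hneg 0).const_mul (R * l)
  have hfun : ∀ t : ℝ, R * Real.exp (-t / δ) * (l * (Real.exp (l * t) - 1))
      = R * l * Real.exp ((l - 1 / δ) * t) - R * l * Real.exp (-1 / δ * t) := fun t => by
    have : (l - 1 / δ) * t = -t / δ + l * t := by ring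
    rw [this, Real.exp_add, show -1 / δ * t = -t / δ by ring]
    ring
  rw [hlc]
  calc ∫⁻ t in Set.Ioi 0, ν {ω | t ≤ f ω} * ENNReal.ofReal (l * (Real.exp (l * t) - 1))
      ≤ ∫⁻ t in Set.Ioi (0 : ℝ), ENNReal.ofReal
          (R * Real.exp (-t / δ) * (l * (Real.exp (l * t) - 1))) * ν Set.univ := by
        refine setLIntegral_mono' measurableSet_Ioi fun t ht => ?_
        rw [ENNReal.ofReal_mul (show 0 ≤ R * Real.exp (-t / δ) by positivity),
          mul_right_comm (ENNReal.ofReal _)]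
        exact mul_le_mul_left (htail t (le_of_lt ht)) _
    _ = ENNReal.ofReal (∫ t in Set.Ioi (0 : ℝ),
          R * Real.exp (-t / δ) * (l * (Real.exp (l * t) - 1))) * ν Set.univ := by
        rw [lintegral_mul_const _ (by fun_prop), ofReal_integral_eq_lintegral_ofReal]
        · simp only [hfun]
          exact hint₁.sub hint₂
        · filter_upwards [ae_restrict_mem measurableSet_Ioi] with t ht
          exact mul_nonneg (by positivity) (hg0 t (le_of_lt ht))
    _ ≤ ENNReal.ofReal (2 * R * (l * δ) ^ 2) * ν Set.univ := by
        gcongr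
        simp only [hfun]
        rw [integral_sub hint₁ hint₂, integral_const_mul, integral_const_mul,
          integral_exp_mul_Ioi hneg', integral_exp_mul_Ioi hneg]
        have hpos : 0 < 1 - l * δ := by linarith
        have hne : l * δ - 1 ≠ 0 := by linarith
        have heq : R * l * (-Real.exp ((l - 1 / δ) * 0) / (l - 1 / δ))
            - R * l * (-Real.exp (-1 / δ * 0) / (-1 / δ)) = R * (l * δ) ^ 2 / (1 - l * δ) := by
          have h1 : l - 1 / δ = -(1 - l * δ) / δ := by field_simp; ring
          rw [h1]
          simp only [mul_zero, Real.exp_zero]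
          field_simp
          ring
        rw [heq, div_le_iff₀ hpos]
        nlinarith [mul_nonneg hR (sq_nonneg (l * δ))]

lemma lintegral_exp_le_of_mean_of_tail {Ω : Type*} [MeasurableSpace Ω] {ν : Measure Ω}
    [IsFiniteMeasure ν] {Z : Ω → ℝ} (hZ : Measurable Z) (hZ0 : ∀ ω, 0 ≤ Z ω)
    {R δ l a : ℝ} (hR : 0 ≤ R) (hδ : 0 < δ) (hl : 0 ≤ l) (hlδ : l * δ ≤ 1 / 2) (ha : 0 ≤ a)
    (hmean : ∫⁻ ω, ENNReal.ofReal (Z ω) ∂ν ≤ ENNReal.ofReal (1 + a) * ν Set.univ)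
    (htail : ∀ t, 0 ≤ t →
      ν {ω | t ≤ |Z ω - 1|} ≤ ENNReal.ofReal (R * Real.exp (-t / δ)) * ν Set.univ) :
    ∫⁻ ω, ENNReal.ofReal (Real.exp (l * (Z ω - 1))) ∂ν
      ≤ ENNReal.ofReal (1 + l * a + 2 * R * (l * δ) ^ 2) * ν Set.univ := by
  have hG := lintegral_exp_sub_one_sub_le_of_tail (hZ.sub_const 1).abs
    (fun ω => abs_nonneg _) hR hδ hl hlδ htail
  have hfin : ENNReal.ofReal l * ν Set.univ ≠ ⊤ := by finiteness
  refine (ENNReal.add_le_add_iff_right hfin).1 ?_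
  calc ∫⁻ ω, ENNReal.ofReal (Real.exp (l * (Z ω - 1))) ∂ν + ENNReal.ofReal l * ν Set.univ
      = ∫⁻ ω, (ENNReal.ofReal (Real.exp (l * (Z ω - 1))) + ENNReal.ofReal l) ∂ν := by
        rw [lintegral_add_right _ measurable_const, lintegral_const]
    _ ≤ ∫⁻ ω, (1 + ENNReal.ofReal l * ENNReal.ofReal (Z ω)
          + ENNReal.ofReal (Real.exp (l * |Z ω - 1|) - 1 - l * |Z ω - 1|)) ∂ν := by
        refine lintegral_mono fun ω => ?_
        have h := exp_sub_one_sub_le_abs (l * (Z ω - 1))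
        rw [abs_mul, abs_of_nonneg hl] at h
        have h0 : 0 ≤ Real.exp (l * |Z ω - 1|) - 1 - l * |Z ω - 1| := by
          linarith [Real.add_one_le_exp (l * |Z ω - 1|)]
        have hlZ := mul_nonneg hl (hZ0 ω)
        rw [← ENNReal.ofReal_add (Real.exp_pos _).le hl, ← ENNReal.ofReal_mul hl,
          ← ENNReal.ofReal_one, ← ENNReal.ofReal_add zero_le_one hlZ,
          ← ENNReal.ofReal_add (by positivity) h0]
        exact ENNReal.ofReal_le_ofReal (by linarith)
    _ = ν Set.univ + ENNReal.ofReal l * ∫⁻ ω, ENNReal.ofReal (Z ω) ∂ν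
          + ∫⁻ ω, ENNReal.ofReal (Real.exp (l * |Z ω - 1|) - 1 - l * |Z ω - 1|) ∂ν := by
        rw [lintegral_add_right _ (by fun_prop), lintegral_add_right _ (by fun_prop),
          lintegral_const_mul _ (by fun_prop), lintegral_const, one_mul]
    _ ≤ ν Set.univ + ENNReal.ofReal l * (ENNReal.ofReal (1 + a) * ν Set.univ)
          + ENNReal.ofReal (2 * R * (l * δ) ^ 2) * ν Set.univ := by gcongr
    _ = ENNReal.ofReal (1 + l * a + 2 * R * (l * δ) ^ 2) * ν Set.univ
          + ENNReal.ofReal l * ν Set.univ := by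
        rw [← mul_assoc, ← ENNReal.ofReal_mul hl, ← add_mul, ← ENNReal.ofReal_add
          (by positivity) hl]
        nth_rewrite 1 [← one_mul (ν Set.univ)]
        rw [← ENNReal.ofReal_one, ← add_mul, ← add_mul, ← ENNReal.ofReal_add zero_le_one
          (by positivity), ← ENNReal.ofReal_add (by positivity) (by positivity)]
        congr 2
        ring

lemma pastSigma_le {Ω : Type*} [MeasurableSpace Ω] {Z : ℕ → Ω → ℝ}
    (hZ : ∀ i, Measurable (Z i)) (i : ℕ) : pastSigma Z i ≤ ‹MeasurableSpace Ω› :=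
  (measurable_pi_lambda _ fun j : Fin i => hZ j).comap_le

lemma measurable_pastSigma {Ω : Type*} [MeasurableSpace Ω] (Z : ℕ → Ω → ℝ) {i j : ℕ}
    (hji : j < i) : Measurable[pastSigma Z i] (Z j) :=
  (measurable_pi_apply (⟨j, hji⟩ : Fin i)).comp
    (comap_measurable fun ω => fun j : Fin i => Z j ω)

lemma lintegral_exp_sum_le {Ω : Type*} [MeasurableSpace Ω] (μ : Measure Ω)
    [IsProbabilityMeasure μ] {R δ l a : ℝ} (hR : 0 ≤ R) (hδ : 0 < δ) (hl : 0 ≤ l)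
    (hlδ : l * δ ≤ 1 / 2) (ha : 0 ≤ a) {k : ℕ}
    {Z : ℕ → Ω → ℝ} (hZm : ∀ i, Measurable (Z i)) (hZ0 : ∀ i ω, 0 ≤ Z i ω)
    (hZint : ∀ i, Integrable (Z i) μ)
    (hcond : ∀ i < k, ∀ᵐ ω ∂μ, (μ[Z i | pastSigma Z i]) ω ≤ 1 + a)
    (htail : ∀ i < k, ∀ t : ℝ, 0 ≤ t →
      ∀ᵐ ω ∂μ, (μ[Set.indicator {ω' | t ≤ |Z i ω' - 1|} (fun _ => (1 : ℝ)) |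
        pastSigma Z i]) ω ≤ R * Real.exp (-t / δ)) :
    ∫⁻ ω, ENNReal.ofReal (Real.exp (l * ∑ i ∈ range k, (Z i ω - 1))) ∂μ
      ≤ ENNReal.ofReal (1 + l * a + 2 * R * (l * δ) ^ 2) ^ k := by
  induction k with
  | zero => simp
  | succ n ih =>
    specialize ih (fun i hi => hcond i (by lia)) (fun i hi => htail i (by lia))
    have hn := n.lt_succ_self
    set W : Ω → ENNReal :=
      fun ω => ENNReal.ofReal (Real.exp (l * ∑ i ∈ range n, (Z i ω - 1))) with hWdef
    have hm := pastSigma_le hZm n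
    have hW : Measurable[pastSigma Z n] W :=
      ENNReal.measurable_ofReal.comp (Real.measurable_exp.comp (Measurable.const_mul
        (Finset.measurable_sum _ fun i hi =>
          (measurable_pastSigma Z (mem_range.1 hi)).sub_const 1) l))
    have hW' : Measurable W := hW.mono hm le_rfl
    have hfin : ∫⁻ ω, W ω ∂μ ≠ ⊤ := (ih.trans_lt (by finiteness)).ne
    have : IsFiniteMeasure (μ.withDensity W) := isFiniteMeasure_withDensity hfin
    have huniv : μ.withDensity W Set.univ = ∫⁻ ω, W ω ∂μ := by simp
    have hstep := lintegral_exp_le_of_mean_of_tail (ν := μ.withDensity W) (hZm n) (hZ0 n) hR hδ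
      hl hlδ ha
      (by
        rw [huniv, lintegral_withDensity_eq_lintegral_mul _ hW' (hZm n).ennreal_ofReal]
        exact lintegral_mul_ofReal_le_of_condExp_le hm (hZint n) (hZm n) (hZ0 n)
          (by positivity) (hcond n hn) hW)
      (fun t ht => by
        have hs : MeasurableSet {ω | t ≤ |Z n ω - 1|} :=
          measurableSet_le measurable_const ((hZm n).sub_const 1).abs
        have h := lintegral_mul_ofReal_le_of_condExp_le hm
          ((integrable_const (1 : ℝ)).indicator hs) (measurable_const.indicator hs)
          (fun ω => Set.indicator_nonneg (fun _ _ => zero_le_one) ω)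
          (by positivity) (htail n hn t ht) hW
        rw [huniv, withDensity_apply _ hs, ← lintegral_indicator hs]
        refine le_trans (le_of_eq (lintegral_congr fun ω => ?_)) h
        by_cases hω : ω ∈ {ω | t ≤ |Z n ω - 1|} <;> simp [Set.indicator, hω])
    rw [huniv, lintegral_withDensity_eq_lintegral_mul _ hW'
      (by have := hZm n; fun_prop)] at hstep
    calc ∫⁻ ω, ENNReal.ofReal (Real.exp (l * ∑ i ∈ range (n + 1), (Z i ω - 1))) ∂μ
        = ∫⁻ ω, W ω * ENNReal.ofReal (Real.exp (l * (Z n ω - 1))) ∂μ := by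
          refine lintegral_congr fun ω => ?_
          rw [sum_range_succ, mul_add, Real.exp_add, ENNReal.ofReal_mul (Real.exp_pos _).le]
      _ ≤ _ := hstep
      _ ≤ _ := by rw [pow_succ' _ n]; gcongr

lemma prod_le_exp_sum_sub_one {ι : Type*} (s : Finset ι) {z : ι → ℝ} (hz : ∀ i ∈ s, 0 ≤ z i) :
    ∏ i ∈ s, z i ≤ Real.exp (∑ i ∈ s, (z i - 1)) := by
  rw [Real.exp_sum]
  exact prod_le_prod hz fun i _ => by linarith [Real.add_one_le_exp (z i - 1)]

lemma measure_prod_ge_le_exp {Ω : Type*} [MeasurableSpace Ω] (μ : Measure Ω)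
    [IsProbabilityMeasure μ] {R δ l : ℝ} (hR : 0 ≤ R) (hδ : 0 < δ) (hl : 0 ≤ l)
    (hlδ : l * δ ≤ 1 / 2) {k : ℕ} (hk : 1 ≤ k)
    {Z : ℕ → Ω → ℝ} (hZm : ∀ i, Measurable (Z i)) (hZ0 : ∀ i ω, 0 ≤ Z i ω)
    (hZint : ∀ i, Integrable (Z i) μ)
    (hcond : ∀ i < k, ∀ᵐ ω ∂μ, (μ[Z i | pastSigma Z i]) ω ≤ 1 + 1 / (20 * k))
    (htail : ∀ i < k, ∀ t : ℝ, 0 ≤ t →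
      ∀ᵐ ω ∂μ, (μ[Set.indicator {ω' | t ≤ |Z i ω' - 1|} (fun _ => (1 : ℝ)) |
        pastSigma Z i]) ω ≤ R * Real.exp (-t / δ)) :
    (μ {ω | 1.1 ≤ ∏ i ∈ range k, Z i ω}).toReal
      ≤ Real.exp (-l / 40 + 2 * k * R * (l * δ) ^ 2) := by
  have hk0 : (0 : ℝ) < k := by exact_mod_cast hk
  have hmoment := lintegral_exp_sum_le μ hR hδ hl hlδ (by positivity) hZm hZ0 hZint hcond htail
  refine ENNReal.toReal_le_of_le_ofReal (Real.exp_pos _).le ?_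
  set b : ℝ := Real.exp (l * 0.075) with hb
  have hb0 : ENNReal.ofReal b ≠ 0 := by simp [hb, Real.exp_pos]
  have hsub : {ω | 1.1 ≤ ∏ i ∈ range k, Z i ω} ⊆ {ω | ENNReal.ofReal b
      ≤ ENNReal.ofReal (Real.exp (l * ∑ i ∈ range k, (Z i ω - 1)))} := fun ω hω => by
    have h1 := le_trans hω (prod_le_exp_sum_sub_one (range k) fun i _ => hZ0 i ω)
    have h2 := (Real.log_le_iff_le_exp (by norm_num)).2 h1
    have h3 := Real.one_sub_inv_le_log_of_pos (show (0 : ℝ) < 1.1 by norm_num)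
    refine ENNReal.ofReal_le_ofReal (Real.exp_le_exp.2 (mul_le_mul_of_nonneg_left ?_ hl))
    norm_num at h2 h3 ⊢
    linarith
  calc μ {ω | 1.1 ≤ ∏ i ∈ range k, Z i ω}
      ≤ _ := measure_mono hsub
    _ ≤ _ := meas_ge_le_lintegral_div (by fun_prop) hb0 ENNReal.ofReal_ne_top
    _ ≤ ENNReal.ofReal (1 + l * (1 / (20 * k)) + 2 * R * (l * δ) ^ 2) ^ k / ENNReal.ofReal b := by
        gcongr
    _ ≤ _ := by
        rw [← ENNReal.ofReal_pow (by positivity), ← ENNReal.ofReal_div_of_pos (Real.exp_pos _)]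
        refine ENNReal.ofReal_le_ofReal ?_
        rw [div_le_iff₀ (Real.exp_pos _), ← Real.exp_add]
        calc (1 + l * (1 / (20 * k)) + 2 * R * (l * δ) ^ 2) ^ k
            ≤ Real.exp (l * (1 / (20 * k)) + 2 * R * (l * δ) ^ 2) ^ k := by
              gcongr
              linarith [Real.add_one_le_exp (l * (1 / (20 * k)) + 2 * R * (l * δ) ^ 2)]
          _ = _ := by
              rw [← Real.exp_nat_mul]
              congr 1
              field_simp
              ring

/-- Upper-tail bound for a martingale-like product: if nonnegative random variables
`Z 0, …, Z (k-1)` with `k ≤ 1/(320Rδ²)` satisfy, almost surely,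
`E[Z i ∣ Z 0,…,Z (i-1)] ≤ 1 + 1/(20k)` and the conditional tail bound
`Pr[|Z i - 1| ≥ t ∣ Z 0,…,Z (i-1)] ≤ R e^{-t/δ}` for all `t ≥ 0`, then
`Pr[∏ Z i ≥ 1.1] ≤ exp(-1/(80δ) + Rk/2)` when `k < 1/(80Rδ)`, and
`Pr[∏ Z i ≥ 1.1] ≤ exp(-1/(12800Rkδ²))` otherwise. -/
theorem martingale_product_upper_tail {Ω : Type*} [MeasurableSpace Ω] (μ : Measure Ω)
    [IsProbabilityMeasure μ] (R δ : ℝ) (hR : 0 < R) (hδ : 0 < δ)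
    (k : ℕ) (hk : 1 ≤ k) (hkR : (k : ℝ) ≤ 1 / (320 * R * δ ^ 2))
    (Z : ℕ → Ω → ℝ) (hZm : ∀ i, Measurable (Z i)) (hZ0 : ∀ i ω, 0 ≤ Z i ω)
    (hZint : ∀ i, Integrable (Z i) μ)
    (hcond : ∀ i < k, ∀ᵐ ω ∂μ, (μ[Z i | pastSigma Z i]) ω ≤ 1 + 1 / (20 * k))
    (htail : ∀ i < k, ∀ t : ℝ, 0 ≤ t →
      ∀ᵐ ω ∂μ, (μ[Set.indicator {ω' | t ≤ |Z i ω' - 1|} (fun _ => (1 : ℝ)) |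
        pastSigma Z i]) ω ≤ R * Real.exp (-t / δ)) :
    ((k : ℝ) < 1 / (80 * R * δ) →
        (μ {ω | 1.1 ≤ ∏ i ∈ range k, Z i ω}).toReal
          ≤ Real.exp (-1 / (80 * δ) + R * k / 2)) ∧
    (¬ ((k : ℝ) < 1 / (80 * R * δ)) →
        (μ {ω | 1.1 ≤ ∏ i ∈ range k, Z i ω}).toReal
          ≤ Real.exp (-1 / (12800 * R * k * δ ^ 2))) := by
  have hk0 : (0 : ℝ) < k := by exact_mod_cast hk
  refine ⟨fun _ => ?_, fun hlarge => ?_⟩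
  · have h := measure_prod_ge_le_exp μ (l := 1 / (2 * δ)) hR.le hδ (by positivity)
      (le_of_eq (by field_simp)) hk hZm hZ0 hZint hcond htail
    convert h using 2
    field_simp
    ring
  · have hlδ : 1 / (160 * R * k * δ ^ 2) * δ ≤ 1 / 2 := by
      rw [not_lt, div_le_iff₀ (by positivity)] at hlarge
      rw [div_mul_eq_mul_div, div_le_iff₀ (by positivity)]
      nlinarith [mul_le_mul_of_nonneg_right hlarge hδ.le]
    have h := measure_prod_ge_le_exp μ (l := 1 / (160 * R * k * δ ^ 2)) hR.le hδ
      (by positivity) hlδ hk hZm hZ0 hZint hcond htail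
    convert h using 2
    field_simp
    ring
end

section
/- Suppose $f: S^{n-1} \to \mathbb{R}$ satisfies $\|f\|_1 = 1$ and $\|f\|_\infty \leq M$ (with $M \geq 1$). Then for every $k \geq 1$, $\|\mathrm{Proj}_{\mathcal{S}_k} f\|_2 \leq \left(e \cdot \max\left(1, \frac{\log M}{\lambda_k/(2n-2)}\right)\right)^{\lambda_k/(2n-2)}$, where $\lambda_k = k(k+n-2)$. -/
open MeasureTheory Metric

/-- The uniform (rotation-invariant) probability measure on the unit sphere
`S^{n-1} ⊂ ℝⁿ`. -/
noncomputable def uSphere (n : ℕ) : Measure (sphere (0 : EuclideanSpace ℝ (Fin n)) 1) :=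
  ((volume : Measure (EuclideanSpace ℝ (Fin n))).toSphere Set.univ)⁻¹ •
    (volume : Measure (EuclideanSpace ℝ (Fin n))).toSphere

/-- The map between unit spheres induced by a linear isometry. -/
noncomputable def sphereMap {m n : ℕ}
    (e : EuclideanSpace ℝ (Fin m) →ₗᵢ[ℝ] EuclideanSpace ℝ (Fin n))
    (ω : sphere (0 : EuclideanSpace ℝ (Fin m)) 1) :
    sphere (0 : EuclideanSpace ℝ (Fin n)) 1 :=
  ⟨e ω, by
    have hω : ‖(ω : EuclideanSpace ℝ (Fin m))‖ = 1 := mem_sphere_zero_iff_norm.mp ω.2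
    simp [mem_sphere_zero_iff_norm, e.norm_map, hω]⟩

/-- The average of `f : S^{n-1} → ℝ` over the equator parametrized by the linear
isometry `e : ℝ^{n-1} → ℝⁿ` (whose range is the hyperplane orthogonal to a point). -/
noncomputable def equatorAvg {n : ℕ} (f : sphere (0 : EuclideanSpace ℝ (Fin n)) 1 → ℝ)
    (e : EuclideanSpace ℝ (Fin (n - 1)) →ₗᵢ[ℝ] EuclideanSpace ℝ (Fin n)) : ℝ :=
  ∫ ω, f (sphereMap e ω) ∂uSphere (n - 1)

/-- `f` is a polynomial function of degree at most `k`, in the sense that all its iterated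
symmetric differences of order `k` are constant. -/
def IsDiffDegLE {E : Type*} [AddCommGroup E] : ℕ → (E → ℝ) → Prop
  | 0, f => ∀ x y, f x = f y
  | k + 1, f => ∀ v, IsDiffDegLE k (fun x => f (x + v) - f (x - v))

namespace IsDiffDegLE

variable {E : Type*} [AddCommGroup E] {k l : ℕ} {f g : E → ℝ}

lemma add (hf : IsDiffDegLE k f) (hg : IsDiffDegLE k g) :
    IsDiffDegLE k (fun x => f x + g x) := by
  induction k generalizing f g with
  | zero => intro x y; simp only [hf x y, hg x y]
  | succ k ih =>
    intro v
    have := ih (hf v) (hg v)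
    convert this using 2
    ring

lemma const_mul (c : ℝ) (hf : IsDiffDegLE k f) : IsDiffDegLE k (fun x => c * f x) := by
  induction k generalizing f with
  | zero => intro x y; simp only [hf x y]
  | succ k ih =>
    intro v
    have := ih (hf v)
    convert this using 2
    ring

lemma comp_add (w : E) (hf : IsDiffDegLE k f) : IsDiffDegLE k (fun x => f (x + w)) := by
  induction k generalizing f with
  | zero => intro x y; exact hf _ _
  | succ k ih =>
    intro v
    have := ih (hf v)
    convert this using 4 <;> abel

lemma zero (k : ℕ) : IsDiffDegLE k (fun _ : E => 0) := by
  induction k with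
  | zero => intro x y; rfl
  | succ k ih => intro v; simpa using ih

lemma sum {ι : Type*} (s : Finset ι) {F : ι → E → ℝ} (h : ∀ i ∈ s, IsDiffDegLE k (F i)) :
    IsDiffDegLE k (fun x => ∑ i ∈ s, F i x) := by
  classical
  induction s using Finset.induction_on with
  | empty => simpa using zero k
  | insert a s ha ih =>
    simp only [Finset.sum_insert ha]
    exact (h a (by simp)).add (ih fun i hi => h i (by simp [hi]))

lemma mul (hf : IsDiffDegLE k f) (hg : IsDiffDegLE l g) :
    IsDiffDegLE (k + l) (fun x => f x * g x) := by
  induction hd : k + l generalizing k l f g with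
  | zero =>
    obtain ⟨rfl, rfl⟩ : k = 0 ∧ l = 0 := by omega
    intro x y
    simp only [hf x y, hg x y]
  | succ d ih =>
    rcases k with _ | k
    · have : (fun x => f x * g x) = fun x => f 0 * g x := by
        ext x; rw [hf x 0]
      rw [this, ← hd, Nat.zero_add]
      exact hg.const_mul _
    rcases l with _ | l
    · have : (fun x => f x * g x) = fun x => g 0 * f x := by
        ext x; rw [hg x 0, mul_comm]
      rw [this, ← hd]
      exact hf.const_mul _
    intro v
    have hS {j : ℕ} {u : E → ℝ} (hu : IsDiffDegLE j u) :
        IsDiffDegLE j (fun x => u (x + v) + u (x - v)) := by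
      simpa only [sub_eq_add_neg] using (hu.comp_add v).add (hu.comp_add (-v))
    have h1 := ih (hf v) (hS hg) (by omega)
    have h2 := ih (hS hf) (hg v) (by omega)
    convert (h1.add h2).const_mul (1 / 2) using 2
    ring

lemma pow (hf : IsDiffDegLE 1 f) (m : ℕ) : IsDiffDegLE m (fun x => f x ^ m) := by
  induction m with
  | zero => intro x y; simp
  | succ m ih => simpa only [pow_succ] using ih.mul hf

lemma prod {ι : Type*} (s : Finset ι) {F : ι → E → ℝ} {d : ι → ℕ}
    (h : ∀ i ∈ s, IsDiffDegLE (d i) (F i)) :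
    IsDiffDegLE (∑ i ∈ s, d i) (fun x => ∏ i ∈ s, F i x) := by
  classical
  induction s using Finset.induction_on with
  | empty => intro x y; simp
  | insert a s ha ih =>
    simp only [Finset.prod_insert ha, Finset.sum_insert ha]
    exact (h a (by simp)).mul (ih fun i hi => h i (by simp [hi]))

end IsDiffDegLE

lemma MvPolynomial.IsHomogeneous.isDiffDegLE_eval {n k : ℕ} {P : MvPolynomial (Fin n) ℝ}
    (hP : P.IsHomogeneous k) : IsDiffDegLE k (fun x : Fin n → ℝ => eval x P) := by
  simp only [eval_eq']
  refine .sum _ fun d hd => .const_mul _ ?_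
  have hdeg : ∑ i, d i = k := by
    have := hP (mem_support_iff.mp hd)
    rw [← this, ← Finsupp.degree_eq_sum]
    exact DFunLike.congr_fun Finsupp.degree_eq_weight_one d
  rw [← hdeg]
  exact .prod _ fun i _ => .pow (fun v x y => by simp) _

/-- The expectation of `F` at the end of a random walk from `0` whose steps are `±v` for the
successive vectors `v` of a list. -/
noncomputable def walkAvg {E : Type*} [AddCommGroup E] : List E → (E → ℝ) → ℝ
  | [], F => F 0
  | v :: l, F => (walkAvg l (fun x => F (x + v)) + walkAvg l (fun x => F (x - v))) / 2

section walkAvg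

variable {E : Type*} [AddCommGroup E]

lemma walkAvg_const (l : List E) (c : ℝ) : walkAvg l (fun _ => c) = c := by
  induction l with
  | nil => rfl
  | cons v l ih => simp [walkAvg, ih]

lemma walkAvg_add (l : List E) (F G : E → ℝ) :
    walkAvg l (fun x => F x + G x) = walkAvg l F + walkAvg l G := by
  induction l generalizing F G with
  | nil => rfl
  | cons v l ih => simp only [walkAvg, ih]; ring

lemma walkAvg_const_mul (l : List E) (c : ℝ) (F : E → ℝ) :
    walkAvg l (fun x => c * F x) = c * walkAvg l F := by
  induction l generalizing F with
  | nil => rfl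
  | cons v l ih => simp only [walkAvg, ih]; ring

lemma walkAvg_sum {ι : Type*} (l : List E) (s : Finset ι) (F : ι → E → ℝ) :
    walkAvg l (fun x => ∑ i ∈ s, F i x) = ∑ i ∈ s, walkAvg l (F i) := by
  classical
  induction s using Finset.induction_on with
  | empty => simpa using walkAvg_const l 0
  | insert a s ha ih => simp only [Finset.sum_insert ha, walkAvg_add, ih]

lemma walkAvg_mono (l : List E) {F G : E → ℝ} (h : ∀ x, F x ≤ G x) :
    walkAvg l F ≤ walkAvg l G := by
  induction l generalizing F G with
  | nil => exact h 0
  | cons v l ih =>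
    have h1 := ih (fun x => h (x + v))
    have h2 := ih (fun x => h (x - v))
    simp only [walkAvg]; linarith

lemma walkAvg_nonneg (l : List E) {F : E → ℝ} (h : ∀ x, 0 ≤ F x) : 0 ≤ walkAvg l F := by
  simpa [walkAvg_const] using walkAvg_mono l h

/-- Minkowski's inequality for the random walk average. -/
lemma walkAvg_add_pow_le (l : List E) (m : ℕ) {u w : E → ℝ} (hu : ∀ x, 0 ≤ u x)
    (hw : ∀ x, 0 ≤ w x) {a b : ℝ} (ha : 0 ≤ a) (hb : 0 ≤ b)
    (hua : walkAvg l (fun x => u x ^ m) ≤ a ^ m) (hwb : walkAvg l (fun x => w x ^ m) ≤ b ^ m) :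
    walkAvg l (fun x => (u x + w x) ^ m) ≤ (a + b) ^ m := by
  have key : ∀ δ > 0, walkAvg l (fun x => (u x + w x) ^ m) ≤ ((a + δ) + (b + δ)) ^ m := by
    intro δ hδ
    set A := a + δ
    set B := b + δ
    have hA : 0 < A := by positivity
    have hB : 0 < B := by positivity
    have hua' : walkAvg l (fun x => u x ^ m) ≤ A ^ m :=
      hua.trans (pow_le_pow_left₀ ha (by simp [A, hδ.le]) _)
    have hwb' : walkAvg l (fun x => w x ^ m) ≤ B ^ m :=
      hwb.trans (pow_le_pow_left₀ hb (by simp [B, hδ.le]) _)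
    have hpt : ∀ x, (u x + w x) ^ m ≤
        ((A + B) ^ m * (A / (A + B)) / A ^ m) * u x ^ m +
          ((A + B) ^ m * (B / (A + B)) / B ^ m) * w x ^ m := by
      intro x
      have hc := (convexOn_pow (𝕜 := ℝ) m).2
        (Set.mem_Ici.2 (div_nonneg (hu x) hA.le)) (Set.mem_Ici.2 (div_nonneg (hw x) hB.le))
        (show 0 ≤ A / (A + B) by positivity) (show 0 ≤ B / (A + B) by positivity)
        (by field_simp)
      have e : A / (A + B) * (u x / A) + B / (A + B) * (w x / B) = (u x + w x) / (A + B) := by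
        field_simp
      simp only [smul_eq_mul, e, div_pow] at hc
      rw [div_le_iff₀ (by positivity)] at hc
      refine hc.trans_eq ?_
      ring
    refine (walkAvg_mono l hpt).trans ?_
    rw [walkAvg_add, walkAvg_const_mul, walkAvg_const_mul]
    calc _ ≤ ((A + B) ^ m * (A / (A + B)) / A ^ m) * A ^ m +
          ((A + B) ^ m * (B / (A + B)) / B ^ m) * B ^ m := by gcongr
      _ = (A + B) ^ m := by field_simp
  have hlim : Filter.Tendsto (fun δ : ℝ => ((a + δ) + (b + δ)) ^ m) (nhdsWithin 0 (Set.Ioi 0))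
      (nhds ((a + b) ^ m)) := by
    have : Continuous (fun δ : ℝ => ((a + δ) + (b + δ)) ^ m) := by fun_prop
    simpa using (this.tendsto 0).mono_left nhdsWithin_le_nhds
  exact ge_of_tendsto hlim (Filter.eventually_of_mem self_mem_nhdsWithin key)

end walkAvg

lemma Nat.choose_two_mul_le (m j : ℕ) (hj : j ≤ m) :
    ((2 * m).choose (2 * j) : ℝ) ≤ m.choose j * (2 * m - 1 : ℝ) ^ j := by
  induction j with
  | zero => simp
  | succ j ih =>
    have ih := ih (by omega)
    have e1 := Nat.choose_succ_right_eq m j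
    have e2 := Nat.choose_succ_right_eq (2 * m) (2 * j)
    have e3 := Nat.choose_succ_right_eq (2 * m) (2 * j + 1)
    have hjm : (j : ℝ) + 1 ≤ m := by exact_mod_cast hj
    have hj0 : (0 : ℝ) ≤ j := by positivity
    have e1' : (m.choose (j + 1) : ℝ) * (j + 1) = m.choose j * (m - j) := by
      have := congrArg (Nat.cast : ℕ → ℝ) e1
      push_cast [Nat.cast_sub (show j ≤ m by omega)] at this
      exact this
    have e2' : ((2 * m).choose (2 * j + 1) : ℝ) * (2 * j + 1)
        = (2 * m).choose (2 * j) * (2 * m - 2 * j) := by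
      have := congrArg (Nat.cast : ℕ → ℝ) e2
      push_cast [Nat.cast_sub (show 2 * j ≤ 2 * m by omega)] at this
      exact this
    have e3' : ((2 * m).choose (2 * (j + 1)) : ℝ) * (2 * j + 2)
        = (2 * m).choose (2 * j + 1) * (2 * m - 2 * j - 1) := by
      have := congrArg (Nat.cast : ℕ → ℝ) e3
      push_cast [Nat.cast_sub (show 2 * j + 1 ≤ 2 * m by omega)] at this
      have h2 : 2 * (j + 1) = 2 * j + 1 + 1 := by ring
      rw [h2]
      linarith
    have e4 : ((2 * m).choose (2 * (j + 1)) : ℝ) * ((j + 1) * (2 * j + 1))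
        = (2 * m).choose (2 * j) * (m - j) * (2 * m - 2 * j - 1) := by
      linear_combination (2 * (j : ℝ) + 1) / 2 * e3' + (2 * (m : ℝ) - 2 * j - 1) / 2 * e2'
    refine le_of_mul_le_mul_right ?_ (show (0 : ℝ) < (j + 1) * (2 * j + 1) by positivity)
    rw [e4]
    have hK : (0 : ℝ) ≤ 2 * m - 2 * j - 1 := by linarith
    have hmj : (0 : ℝ) ≤ m - j := by linarith
    have hp : (0 : ℝ) ≤ m.choose j * (2 * m - 1 : ℝ) ^ j :=
      mul_nonneg (by positivity) (pow_nonneg (by linarith) _)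
    calc _ ≤ (m.choose j * (2 * m - 1 : ℝ) ^ j) * (m - j) * ((2 * m - 1) * (2 * j + 1)) := by
          gcongr
          nlinarith
      _ = _ := by
        rw [pow_succ]
        linear_combination (-(2 * m - 1 : ℝ) ^ j * (2 * m - 1) * (2 * j + 1)) * e1'

lemma Finset.sum_range_even {M : Type*} [AddCommMonoid M] (φ : ℕ → M) (hφ : ∀ i, Odd i → φ i = 0)
    (m : ℕ) : ∑ i ∈ range (2 * m + 1), φ i = ∑ j ∈ range (m + 1), φ (2 * j) := by
  induction m with
  | zero => simp
  | succ m ih =>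
    rw [show 2 * (m + 1) + 1 = 2 * m + 1 + 1 + 1 by ring, sum_range_succ, sum_range_succ, ih,
      sum_range_succ _ (m + 1), hφ _ ⟨m, rfl⟩, add_zero]
    rfl

/-- The two-point hypercontractive inequality for even exponents, before averaging. -/
lemma add_pow_add_sub_pow_div_two_le (m : ℕ) (g h : ℝ) :
    ((g + h) ^ (2 * m) + (g - h) ^ (2 * m)) / 2 ≤ (g ^ 2 + (2 * m - 1) * h ^ 2) ^ m := by
  have e1 : ((g + h) ^ (2 * m) + (g - h) ^ (2 * m)) / 2 =
      ∑ i ∈ Finset.range (2 * m + 1),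
        (1 + (-1) ^ i) / 2 * (h ^ i * g ^ (2 * m - i) * (2 * m).choose i) := by
    rw [sub_eq_add_neg, add_comm g h, add_comm g (-h), add_pow, add_pow, ← Finset.sum_add_distrib,
      Finset.sum_div]
    refine Finset.sum_congr rfl fun i _ => ?_
    rw [neg_pow h]
    ring
  rw [e1, Finset.sum_range_even _ (fun i hi => by simp [hi.neg_one_pow]), add_comm (g ^ 2),
    add_pow]
  refine Finset.sum_le_sum fun j hj => ?_
  have hj' : j ≤ m := by simpa [Nat.lt_succ_iff] using hj
  have hc := Nat.choose_two_mul_le m j hj'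
  rw [show 2 * m - 2 * j = 2 * (m - j) by omega, mul_pow, pow_mul h, pow_mul g, pow_mul (-1 : ℝ)]
  have h0 : 0 ≤ (h ^ 2) ^ j * (g ^ 2) ^ (m - j) := by positivity
  calc _ = (h ^ 2) ^ j * (g ^ 2) ^ (m - j) * (2 * m).choose (2 * j) := by norm_num
    _ ≤ (h ^ 2) ^ j * (g ^ 2) ^ (m - j) * (m.choose j * (2 * m - 1 : ℝ) ^ j) := by gcongr
    _ = _ := by ring

/-- Bonami's lemma for even exponents. -/
lemma IsDiffDegLE.walkAvg_pow_le {E : Type*} [AddCommGroup E] {k m : ℕ} (hm : 1 ≤ m) {f : E → ℝ}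
    (hf : IsDiffDegLE k f) (l : List E) :
    walkAvg l (fun x => f x ^ (2 * m)) ≤
      ((2 * m - 1 : ℝ) ^ k * walkAvg l (fun x => f x ^ 2)) ^ m := by
  have hK : (1 : ℝ) ≤ 2 * m - 1 := by
    have : (1 : ℝ) ≤ m := by exact_mod_cast hm
    linarith
  induction l generalizing k f with
  | nil =>
    simp only [walkAvg, pow_mul]
    have : 1 ≤ (2 * m - 1 : ℝ) ^ k := one_le_pow₀ hK
    gcongr
    nlinarith [sq_nonneg (f 0)]
  | cons v l ih =>
    rcases k with _ | k
    · obtain ⟨c, rfl⟩ : ∃ c, f = fun _ => c := ⟨f 0, funext fun x => hf x 0⟩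
      simp only [walkAvg_const]
      simp [pow_mul]
    set g : E → ℝ := fun x => 1 / 2 * (f (x + v) + f (x + -v)) with hg
    set h : E → ℝ := fun x => 1 / 2 * (f (x + v) - f (x - v)) with hh
    have hgd : IsDiffDegLE (k + 1) g := ((hf.comp_add v).add (hf.comp_add (-v))).const_mul _
    have hhd : IsDiffDegLE k h := (hf v).const_mul _
    have e1 : ∀ x, f (x + v) = g x + h x := fun x => by
      simp only [hg, hh, sub_eq_add_neg]; ring
    have e2 : ∀ x, f (x - v) = g x - h x := fun x => by
      simp only [hg, hh, sub_eq_add_neg]; ring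
    have half (F G : E → ℝ) : (walkAvg l F + walkAvg l G) / 2
        = walkAvg l (fun x => (F x + G x) / 2) := by
      have := walkAvg_const_mul l (1 / 2) (fun x => F x + G x)
      rw [walkAvg_add] at this
      rw [show (fun x => (F x + G x) / 2) = fun x => 1 / 2 * (F x + G x) by ext; ring, this]
      ring
    simp only [walkAvg, half, e1, e2]
    have hsq : (fun x => ((g x + h x) ^ 2 + (g x - h x) ^ 2) / 2) = fun x => g x ^ 2 + h x ^ 2 := by
      ext; ring
    rw [hsq, walkAvg_add]
    refine (walkAvg_mono l fun x => add_pow_add_sub_pow_div_two_le m (g x) (h x)).trans ?_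
    have hA : 0 ≤ walkAvg l (fun x => g x ^ 2) := walkAvg_nonneg l fun x => by positivity
    have hB : 0 ≤ walkAvg l (fun x => h x ^ 2) := walkAvg_nonneg l fun x => by positivity
    have h1 := ih hgd
    have h2 := ih hhd
    have hK0 : (0 : ℝ) ≤ 2 * m - 1 := by linarith
    refine (walkAvg_add_pow_le l m (a := (2 * m - 1 : ℝ) ^ (k + 1) * walkAvg l (fun x => g x ^ 2))
      (b := (2 * m - 1) * ((2 * m - 1 : ℝ) ^ k * walkAvg l (fun x => h x ^ 2)))
      (fun x => by positivity) (fun x => by positivity)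
      (by positivity) (by positivity) ?_ ?_).trans_eq ?_
    · simpa only [← pow_mul] using h1
    · simp only [mul_pow, walkAvg_const_mul, ← pow_mul]
      simp only [mul_pow, ← pow_mul] at h2
      gcongr
    · ring

/-- The moments of the standard Gaussian distribution. -/
def gaussMoment : ℕ → ℝ
  | 0 => 1
  | 1 => 0
  | r + 2 => (r + 1) * gaussMoment r

/-- Discrete Gaussian integration by parts for the simple random walk on the integers. -/
lemma walkAvg_replicate_one_mul (N : ℕ) (F : ℝ → ℝ) :
    walkAvg (List.replicate (N + 1) 1) (fun x => x * F x) =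
      (N + 1) * walkAvg (List.replicate N 1) (fun x => 1 / 2 * (F (x + 1) - F (x - 1))) := by
  induction N generalizing F with
  | zero => simp [walkAvg]; ring
  | succ N ih =>
    have h := ih (fun x => 1 / 2 * (F (x + 1) + F (x - 1)))
    set W := walkAvg (List.replicate (N + 1) (1 : ℝ)) with hW
    have e1 : walkAvg (List.replicate (N + 1 + 1) 1) (fun x => x * F x) =
        W (fun x => x * (1 / 2 * (F (x + 1) + F (x - 1)))) +
          W (fun x => 1 / 2 * (F (x + 1) - F (x - 1))) := by
      rw [List.replicate_succ, walkAvg, hW, ← walkAvg_add, ← walkAvg_add, div_eq_inv_mul,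
        ← walkAvg_const_mul]
      congr 1; ext x; ring
    have e2 : W (fun x => 1 / 2 * (F (x + 1) - F (x - 1))) =
        walkAvg (List.replicate N 1) (fun x => 1 / 2 * (1 / 2 * (F (x + 1 + 1) + F (x + 1 - 1)) -
          1 / 2 * (F (x - 1 + 1) + F (x - 1 - 1)))) := by
      rw [hW, List.replicate_succ, walkAvg, ← walkAvg_add, div_eq_inv_mul, ← walkAvg_const_mul]
      congr 1; ext x; ring_nf
    rw [e1, h, ← e2]
    push_cast; ring

lemma walkAvg_replicate_mul_pow (N : ℕ) (c : ℝ) (r : ℕ) :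
    walkAvg (List.replicate N c) (fun x => x ^ r) =
      c ^ r * walkAvg (List.replicate N 1) (fun x => x ^ r) := by
  have key : ∀ F : ℝ → ℝ, walkAvg (List.replicate N c) F =
      walkAvg (List.replicate N 1) (fun x => F (c * x)) := by
    induction N with
    | zero => intro F; simp [walkAvg]
    | succ N ih =>
      intro F
      simp only [List.replicate_succ, walkAvg, ih, mul_add, mul_sub, mul_one]
  rw [key, ← walkAvg_const_mul]
  simp only [mul_pow]

lemma walkAvg_replicate_one_pow_succ (N s : ℕ) :
    walkAvg (List.replicate (N + 1) 1) (fun x : ℝ => x ^ (s + 2)) =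
      (N + 1) * ∑ j ∈ Finset.range (s + 1), ((s + 1).choose j * ((1 - (-1) ^ (s + 1 - j)) / 2)) *
        walkAvg (List.replicate N 1) (fun x : ℝ => x ^ j) := by
  have := walkAvg_replicate_one_mul N (fun x => x ^ (s + 1))
  simp only [← pow_succ'] at this
  rw [this]
  congr 1
  simp only [← walkAvg_const_mul, ← walkAvg_sum]
  congr 1; ext x
  rw [sub_eq_add_neg x 1, add_pow, add_pow, ← Finset.sum_sub_distrib, Finset.mul_sum,
    Finset.sum_range_succ]
  simp only [one_pow, mul_one, Nat.sub_self, pow_zero, sub_self, mul_zero, add_zero]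
  exact Finset.sum_congr rfl fun j _ => by ring

/-- The moments of the normalized simple random walk converge to the Gaussian moments. -/
lemma tendsto_walkAvg_pow (r : ℕ) :
    Filter.Tendsto (fun N : ℕ => walkAvg (List.replicate N (√N)⁻¹) (fun x : ℝ => x ^ r))
      Filter.atTop (nhds (gaussMoment r)) := by
  induction r using Nat.strong_induction_on with
  | _ r ih =>
  have hscale (N r : ℕ) : walkAvg (List.replicate N (√N)⁻¹) (fun x : ℝ => x ^ r) = _ :=
    walkAvg_replicate_mul_pow N _ r
  simp only [hscale] at ih ⊢
  match r with
  | 0 => simp [walkAvg_const, gaussMoment]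
  | 1 =>
    rw [← Filter.tendsto_add_atTop_iff_nat 1]
    have : ∀ N : ℕ, walkAvg (List.replicate (N + 1) 1) (fun x : ℝ => x ^ 1) = 0 := fun N => by
      simpa [walkAvg_const] using walkAvg_replicate_one_mul N (fun _ => 1)
    simp only [this, mul_zero, gaussMoment]
    exact tendsto_const_nhds
  | s + 2 =>
    rw [← Filter.tendsto_add_atTop_iff_nat 1]
    set W : ℕ → ℕ → ℝ := fun j N => (√N)⁻¹ ^ j * walkAvg (List.replicate N 1) (fun x : ℝ => x ^ j)
    have hinv : Filter.Tendsto (fun N : ℕ => (√(N + 1 : ℝ))⁻¹) Filter.atTop (nhds 0) := by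
      refine Filter.Tendsto.inv_tendsto_atTop (Real.tendsto_sqrt_atTop.comp ?_)
      exact Filter.tendsto_atTop_add_const_right _ _ tendsto_natCast_atTop_atTop
    have hratio : Filter.Tendsto (fun N : ℕ => √(N : ℝ) * (√(N + 1 : ℝ))⁻¹) Filter.atTop
        (nhds 1) := by
      have := (tendsto_natCast_div_add_atTop (1 : ℝ)).sqrt
      rw [Real.sqrt_one] at this
      refine this.congr fun N => ?_
      rw [Real.sqrt_div (by positivity), div_eq_mul_inv]
    have hlim : Filter.Tendsto (fun N : ℕ => ∑ j ∈ Finset.range (s + 1),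
        ((s + 1).choose j * ((1 - (-1) ^ (s + 1 - j)) / 2)) * (W j N *
          (√(N : ℝ) * (√(N + 1 : ℝ))⁻¹) ^ j * ((√(N + 1 : ℝ))⁻¹) ^ (s - j))) Filter.atTop
        (nhds (∑ j ∈ Finset.range (s + 1), ((s + 1).choose j * ((1 - (-1) ^ (s + 1 - j)) / 2)) *
          (gaussMoment j * 1 ^ j * 0 ^ (s - j)))) := by
      refine tendsto_finsetSum _ fun j hj => Filter.Tendsto.const_mul _ ?_
      exact ((ih j (by simp at hj; omega)).mul (hratio.pow _)).mul (hinv.pow _)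
    have hval : ∑ j ∈ Finset.range (s + 1), ((s + 1).choose j * ((1 - (-1) ^ (s + 1 - j)) / 2)) *
          (gaussMoment j * 1 ^ j * 0 ^ (s - j)) = gaussMoment (s + 2) := by
      rw [Finset.sum_range_succ, Finset.sum_eq_zero]
      · simp [gaussMoment]
      · intro j hj
        rw [zero_pow (by simp at hj; omega)]
        simp
    rw [hval] at hlim
    refine hlim.congr' ?_
    filter_upwards [Filter.eventually_ge_atTop 1] with N hN
    rw [walkAvg_replicate_one_pow_succ, Finset.mul_sum, Finset.mul_sum]
    refine Finset.sum_congr rfl fun j hj => ?_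
    have hj' : j ≤ s := by simpa [Nat.lt_succ_iff] using hj
    have hN0 : (0 : ℝ) < N := by exact_mod_cast hN
    have h1 : (√(N : ℝ))⁻¹ ^ j * √(N : ℝ) ^ j = 1 := by
      rw [← mul_pow, inv_mul_cancel₀ (Real.sqrt_pos.2 hN0).ne', one_pow]
    have h2 : (√((N : ℝ) + 1))⁻¹ ^ 2 * (N + 1) = 1 := by
      rw [inv_pow, Real.sq_sqrt (by positivity), inv_mul_cancel₀ (by positivity)]
    have h3 : (√((N : ℝ) + 1))⁻¹ ^ (s + 2) =
        (√((N : ℝ) + 1))⁻¹ ^ j * (√((N : ℝ) + 1))⁻¹ ^ (s - j) * (√((N : ℝ) + 1))⁻¹ ^ 2 := by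
      rw [← pow_add, ← pow_add]; congr 1; omega
    push_cast
    rw [h3]
    simp only [W]
    linear_combination (((s + 1).choose j * ((1 - (-1) ^ (s + 1 - j)) / 2)) *
        walkAvg (List.replicate N 1) (fun x : ℝ => x ^ j) * (√((N : ℝ) + 1))⁻¹ ^ j *
        (√((N : ℝ) + 1))⁻¹ ^ (s - j)) * (h1 - h2)

lemma walkAvg_map_single_prod {n : ℕ} (l : List (Fin n × ℝ)) (φ : Fin n → ℝ → ℝ) :
    walkAvg (l.map fun p => (Pi.single p.1 p.2 : Fin n → ℝ)) (fun x => ∏ i, φ i (x i)) =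
      ∏ i, walkAvg ((l.filter fun p => p.1 = i).map Prod.snd) (φ i) := by
  induction l generalizing φ with
  | nil => simp [walkAvg]
  | cons p l ih =>
    obtain ⟨i, c⟩ := p
    have hshift (s : ℝ) (x : Fin n → ℝ) : ∏ j, φ j ((x + Pi.single i s : Fin n → ℝ) j) =
        ∏ j, Function.update φ i (fun y => φ i (y + s)) j (x j) := by
      refine Finset.prod_congr rfl fun j _ => ?_
      by_cases h : j = i
      · subst h; simp
      · simp [h]
    have hwalk (s : ℝ) : ∏ j, walkAvg ((l.filter fun p => p.1 = j).map Prod.snd)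
          (Function.update φ i (fun y => φ i (y + s)) j) =
        walkAvg ((l.filter fun p => p.1 = i).map Prod.snd) (fun y => φ i (y + s)) *
          ∏ j ∈ Finset.univ.erase i,
            walkAvg ((l.filter fun p => p.1 = j).map Prod.snd) (φ j) := by
      rw [← Finset.mul_prod_erase _ _ (Finset.mem_univ i)]
      congr 1
      · simp
      · refine Finset.prod_congr rfl fun j hj => ?_
        rw [Function.update_of_ne (Finset.ne_of_mem_erase hj)]
    simp only [List.map_cons, walkAvg, sub_eq_add_neg, ← Pi.single_neg]
    simp only [hshift, ih, hwalk]
    rw [← Finset.mul_prod_erase _ _ (Finset.mem_univ i)]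
    have hrest : ∏ j ∈ Finset.univ.erase i,
          walkAvg ((((i, c) :: l).filter fun p => p.1 = j).map Prod.snd) (φ j) =
        ∏ j ∈ Finset.univ.erase i,
          walkAvg ((l.filter fun p => p.1 = j).map Prod.snd) (φ j) := by
      refine Finset.prod_congr rfl fun j hj => ?_
      rw [List.filter_cons_of_neg (by simpa using (Finset.ne_of_mem_erase hj).symm)]
    rw [hrest, List.filter_cons_of_pos (by simp), List.map_cons, walkAvg]
    simp only [sub_eq_add_neg]
    ring

/-- The steps of a random walk on `ℝⁿ` that makes `N` steps of size `c` along each axis. -/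
def axisSteps (n N : ℕ) (c : ℝ) : List (Fin n × ℝ) :=
  (List.finRange n).flatMap fun i => List.replicate N (i, c)

lemma axisSteps_filter (n N : ℕ) (c : ℝ) (i : Fin n) :
    ((axisSteps n N c).filter fun p => p.1 = i).map Prod.snd = List.replicate N c := by
  have key : ∀ l : List (Fin n), l.Nodup →
      ((l.flatMap fun j => List.replicate N (j, c)).filter fun p => p.1 = i).map Prod.snd =
        if i ∈ l then List.replicate N c else [] := by
    intro l hl
    induction l with
    | nil => simp
    | cons j l ih =>
      rw [List.nodup_cons] at hl
      rw [List.flatMap_cons, List.filter_append, List.map_append, ih hl.2, List.filter_replicate]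
      by_cases h : j = i
      · subst h; simp [hl.1]
      · simp [h, Ne.symm h]
  rw [axisSteps, key _ (List.nodup_finRange n)]
  simp

/-- The expectation of a polynomial in independent standard Gaussian variables. -/
noncomputable def gaussExpect {n : ℕ} (Q : MvPolynomial (Fin n) ℝ) : ℝ :=
  ∑ d ∈ Q.support, Q.coeff d * ∏ i, gaussMoment (d i)

lemma tendsto_walkAvg_axisSteps {n : ℕ} (Q : MvPolynomial (Fin n) ℝ) :
    Filter.Tendsto (fun N : ℕ => walkAvg ((axisSteps n N (√N)⁻¹).map
        fun p => (Pi.single p.1 p.2 : Fin n → ℝ)) (fun x => MvPolynomial.eval x Q))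
      Filter.atTop (nhds (gaussExpect Q)) := by
  simp only [MvPolynomial.eval_eq', walkAvg_sum, walkAvg_const_mul]
  refine tendsto_finsetSum _ fun d _ => Filter.Tendsto.const_mul _ ?_
  have := tendsto_finsetProd Finset.univ fun i (_ : i ∈ Finset.univ) => tendsto_walkAvg_pow (d i)
  refine this.congr fun N => ?_
  rw [walkAvg_map_single_prod _ (fun i y => y ^ d i)]
  simp only [axisSteps_filter]

/-- Gaussian hypercontractivity for homogeneous polynomials and even exponents. -/
lemma gaussExpect_pow_le {n k m : ℕ} (hm : 1 ≤ m) {P : MvPolynomial (Fin n) ℝ}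
    (hP : P.IsHomogeneous k) :
    gaussExpect (P ^ (2 * m)) ≤ ((2 * m - 1 : ℝ) ^ k * gaussExpect (P ^ 2)) ^ m := by
  have h1 := tendsto_walkAvg_axisSteps (P ^ (2 * m))
  have h2 := ((tendsto_walkAvg_axisSteps (P ^ 2)).const_mul ((2 * m - 1 : ℝ) ^ k)).pow m
  refine le_of_tendsto_of_tendsto' h1 h2 fun N => ?_
  simp only [map_pow]
  exact hP.isDiffDegLE_eval.walkAvg_pow_le hm _

lemma integrable_pow_mul_exp_neg_half_sq (r : ℕ) :
    Integrable (fun x : ℝ => x ^ r * Real.exp (-(1 / 2) * x ^ 2)) := by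
  have := integrable_rpow_mul_exp_neg_mul_sq (b := 1 / 2) (by norm_num) (s := r)
    (by have : (0 : ℝ) ≤ r := by positivity
        linarith)
  simpa only [Real.rpow_natCast] using this

lemma integral_pow_mul_exp_neg_half_sq (r : ℕ) :
    ∫ x : ℝ, x ^ r * Real.exp (-(1 / 2) * x ^ 2) = √(2 * Real.pi) * gaussMoment r := by
  have hexp (x : ℝ) : HasDerivAt (fun x : ℝ => Real.exp (-(1 / 2) * x ^ 2))
      (-x * Real.exp (-(1 / 2) * x ^ 2)) x := by
    have := ((hasDerivAt_pow 2 x).const_mul (-(1 / 2 : ℝ))).exp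
    convert this using 1
    push_cast; ring
  induction r using Nat.strong_induction_on with
  | _ r ih =>
  match r with
  | 0 =>
    simp only [pow_zero, one_mul, integral_gaussian, gaussMoment, mul_one]
    congr 1; ring
  | 1 =>
    have h := integral_eq_zero_of_hasDerivAt_of_integrable hexp
      (by simpa using (integrable_pow_mul_exp_neg_half_sq 1).neg)
      (by simpa using integrable_pow_mul_exp_neg_half_sq 0)
    simp only [neg_mul, integral_neg, neg_eq_zero] at h
    simpa [gaussMoment] using h
  | s + 2 =>
    have h := integral_eq_zero_of_hasDerivAt_of_integrable
      (f' := fun x => (s + 1) * (x ^ s * Real.exp (-(1 / 2) * x ^ 2)) -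
        x ^ (s + 2) * Real.exp (-(1 / 2) * x ^ 2))
      (fun x => ((hasDerivAt_pow (s + 1) x).mul (hexp x)).congr_deriv
        (by simp only [Nat.add_sub_cancel]; push_cast; ring))
      (((integrable_pow_mul_exp_neg_half_sq s).const_mul _).sub
        (integrable_pow_mul_exp_neg_half_sq (s + 2)))
      (integrable_pow_mul_exp_neg_half_sq (s + 1))
    rw [integral_sub ((integrable_pow_mul_exp_neg_half_sq s).const_mul _)
      (integrable_pow_mul_exp_neg_half_sq (s + 2)), integral_const_mul, ih s (by omega)] at h
    rw [gaussMoment]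
    linear_combination -h

lemma integral_eval_mul_exp_neg_half_norm_sq {n : ℕ} (Q : MvPolynomial (Fin n) ℝ) :
    ∫ x : EuclideanSpace ℝ (Fin n),
        MvPolynomial.eval (fun i => x i) Q * Real.exp (-(1 / 2) * ‖x‖ ^ 2) =
      √(2 * Real.pi) ^ n * gaussExpect Q := by
  rw [← (PiLp.volume_preserving_toLp (Fin n)).integral_comp
    (MeasurableEquiv.toLp 2 (Fin n → ℝ)).measurableEmbedding]
  have e (x : Fin n → ℝ) : MvPolynomial.eval (fun i => WithLp.toLp 2 x i) Q *
      Real.exp (-(1 / 2) * ‖WithLp.toLp 2 x‖ ^ 2) =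
      ∑ d ∈ Q.support, Q.coeff d * ∏ i, (x i ^ d i * Real.exp (-(1 / 2) * x i ^ 2)) := by
    rw [EuclideanSpace.real_norm_sq_eq, Finset.mul_sum, Real.exp_sum, MvPolynomial.eval_eq',
      Finset.sum_mul]
    simp only [Finset.prod_mul_distrib, mul_assoc]
  simp only [e]
  rw [integral_finsetSum]
  · simp only [integral_const_mul, gaussExpect, Finset.mul_sum]
    refine Finset.sum_congr rfl fun d _ => ?_
    rw [integral_fintype_prod_volume_eq_prod
      (fun i (y : ℝ) => y ^ d i * Real.exp (-(1 / 2) * y ^ 2))]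
    simp only [integral_pow_mul_exp_neg_half_sq, Finset.prod_mul_distrib, Finset.prod_const,
      Finset.card_univ, Fintype.card_fin]
    ring
  · intro d _
    exact (Integrable.fintype_prod (f := fun i (y : ℝ) => y ^ d i * Real.exp (-(1 / 2) * y ^ 2))
      fun i => integrable_pow_mul_exp_neg_half_sq (d i)).const_mul _

lemma integral_eq_integral_toSphere_prod {E : Type*} [NormedAddCommGroup E] [NormedSpace ℝ E]
    [MeasurableSpace E] [Nontrivial E] (μ : Measure E) [FiniteDimensional ℝ E] [BorelSpace E]
    [μ.IsAddHaarMeasure] (G : E → ℝ) :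
    ∫ x, G x ∂μ = ∫ p : sphere (0 : E) 1 × Set.Ioi (0 : ℝ), G ((p.2 : ℝ) • (p.1 : E))
      ∂μ.toSphere.prod (.volumeIoiPow (Module.finrank ℝ E - 1)) := by
  have h : ∫ x, G x ∂μ = ∫ x : ({0}ᶜ : Set E), G x ∂(μ.comap (↑)) := by
    rw [integral_subtype_comap (measurableSet_singleton _).compl, restrict_compl_singleton]
  refine (h.trans (integral_congr_ae (.of_forall fun x => ?_))).trans
    (μ.measurePreserving_homeomorphUnitSphereProd.integral_comp
      (homeomorphUnitSphereProd E).measurableEmbedding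
      (fun p : sphere (0 : E) 1 × Set.Ioi (0 : ℝ) => G ((p.2 : ℝ) • (p.1 : E))))
  have hx : ‖(x : E)‖ ≠ 0 := norm_ne_zero_iff.2 x.2
  simp [smul_smul, hx]

lemma MvPolynomial.IsHomogeneous.eval_mul {n d : ℕ} {Q : MvPolynomial (Fin n) ℝ}
    (hQ : Q.IsHomogeneous d) (r : ℝ) (x : Fin n → ℝ) :
    eval (fun i => r * x i) Q = r ^ d * eval x Q := by
  simp only [eval_eq', Finset.mul_sum, mul_pow, Finset.prod_mul_distrib]
  refine Finset.sum_congr rfl fun e he => ?_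
  have hdeg : ∑ i, e i = d := by
    rw [← hQ (mem_support_iff.mp he), ← Finsupp.degree_eq_sum]
    exact DFunLike.congr_fun Finsupp.degree_eq_weight_one e
  rw [Finset.prod_pow_eq_pow_sum, hdeg]
  ring

lemma isProbabilityMeasure_uSphere {n : ℕ} (hn : 0 < n) : IsProbabilityMeasure (uSphere n) := by
  have : Nonempty (Fin n) := ⟨⟨0, hn⟩⟩
  constructor
  rw [uSphere, Measure.smul_apply, smul_eq_mul]
  exact ENNReal.inv_mul_cancel (Measure.measure_univ_ne_zero.2 (Measure.toSphere_ne_zero _))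
    (measure_ne_top _ _)

/-- Polar coordinates for the Gaussian integral of a homogeneous polynomial. -/
lemma integral_eval_mul_exp_eq_integral_uSphere_mul {n d : ℕ} (hn : 0 < n)
    {Q : MvPolynomial (Fin n) ℝ} (hQ : Q.IsHomogeneous d) :
    ∫ x : EuclideanSpace ℝ (Fin n),
        MvPolynomial.eval (fun i => x i) Q * Real.exp (-(1 / 2) * ‖x‖ ^ 2) =
      (∫ x, MvPolynomial.eval (fun i => (x : EuclideanSpace ℝ (Fin n)) i) Q ∂uSphere n) *
        ∫ x : EuclideanSpace ℝ (Fin n), ‖x‖ ^ d * Real.exp (-(1 / 2) * ‖x‖ ^ 2) := by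
  have : Nonempty (Fin n) := ⟨⟨0, hn⟩⟩
  have hν : (volume : Measure (EuclideanSpace ℝ (Fin n))).toSphere.real Set.univ ≠ 0 := by
    rw [Measure.real, ENNReal.toReal_ne_zero]
    exact ⟨Measure.measure_univ_ne_zero.2 (Measure.toSphere_ne_zero _), measure_ne_top _ _⟩
  have h1 (p : sphere (0 : EuclideanSpace ℝ (Fin n)) 1 × Set.Ioi (0 : ℝ)) :
      MvPolynomial.eval (fun i => ((p.2 : ℝ) • (p.1 : EuclideanSpace ℝ (Fin n))) i) Q *
        Real.exp (-(1 / 2) * ‖(p.2 : ℝ) • (p.1 : EuclideanSpace ℝ (Fin n))‖ ^ 2) =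
      MvPolynomial.eval (fun i => (p.1 : EuclideanSpace ℝ (Fin n)) i) Q *
        ((p.2 : ℝ) ^ d * Real.exp (-(1 / 2) * (p.2 : ℝ) ^ 2)) := by
    have h0 : (0 : ℝ) < p.2 := p.2.2
    have := hQ.eval_mul (p.2 : ℝ) (fun i => (p.1 : EuclideanSpace ℝ (Fin n)) i)
    simp only [PiLp.smul_apply, smul_eq_mul, this, norm_smul, Real.norm_eq_abs, abs_of_pos h0,
      norm_eq_of_mem_sphere, mul_one]
    ring
  have h2 (p : sphere (0 : EuclideanSpace ℝ (Fin n)) 1 × Set.Ioi (0 : ℝ)) :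
      ‖(p.2 : ℝ) • (p.1 : EuclideanSpace ℝ (Fin n))‖ ^ d * Real.exp (-(1 / 2) * ‖(p.2 : ℝ) • (p.1 : EuclideanSpace ℝ (Fin n))‖ ^ 2) =
      1 * ((p.2 : ℝ) ^ d * Real.exp (-(1 / 2) * (p.2 : ℝ) ^ 2)) := by
    have h0 : (0 : ℝ) < p.2 := p.2.2
    simp only [norm_smul, Real.norm_eq_abs, abs_of_pos h0, norm_eq_of_mem_sphere, mul_one, one_mul]
  rw [integral_eq_integral_toSphere_prod volume,
    integral_eq_integral_toSphere_prod volume (fun x => ‖x‖ ^ d * _)]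
  simp only [h1, h2]
  rw [integral_prod_mul (fun x : sphere (0 : EuclideanSpace ℝ (Fin n)) 1 => MvPolynomial.eval (fun i => (x : EuclideanSpace ℝ (Fin n)) i) Q)
      (fun r : Set.Ioi (0 : ℝ) => (r : ℝ) ^ d * Real.exp (-(1 / 2) * (r : ℝ) ^ 2)),
    integral_prod_mul (fun _ : sphere (0 : EuclideanSpace ℝ (Fin n)) 1 => (1 : ℝ))
      (fun r : Set.Ioi (0 : ℝ) => (r : ℝ) ^ d * Real.exp (-(1 / 2) * (r : ℝ) ^ 2)),
    uSphere, integral_smul_measure, integral_const, ENNReal.toReal_inv, ← measureReal_def]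
  simp only [smul_eq_mul, mul_one]
  field_simp

/-- Jensen's inequality for powers, with respect to a probability density `w`. -/
lemma pow_integral_mul_le_integral_mul_pow {α : Type*} [MeasurableSpace α] {μ : Measure α}
    {w t : α → ℝ} (m : ℕ) (hw : ∀ x, 0 ≤ w x) (ht : ∀ x, 0 ≤ t x) (hw1 : ∫ x, w x ∂μ = 1)
    (hwt : Integrable (fun x => w x * t x) μ) (hwtm : Integrable (fun x => w x * t x ^ m) μ) :
    (∫ x, w x * t x ∂μ) ^ m ≤ ∫ x, w x * t x ^ m ∂μ := by
  have hwi : Integrable w μ := .of_integral_ne_zero (by simp [hw1])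
  set c := ∫ x, w x * t x ∂μ
  have hc : 0 ≤ c := integral_nonneg fun x => mul_nonneg (hw x) (ht x)
  rcases hc.eq_or_lt with hc0 | hc0
  · rcases m with _ | m
    · simp [hw1]
    · rw [← hc0, zero_pow (by omega)]
      exact integral_nonneg fun x => mul_nonneg (hw x) (pow_nonneg (ht x) _)
  have hpt : ∀ x, c ^ m * (1 - m) * w x + c ^ m * m / c * (w x * t x) ≤ w x * t x ^ m := by
    intro x
    have hb := one_add_mul_le_pow (a := t x / c - 1)
      (by have := div_nonneg (ht x) hc; linarith) m
    rw [add_sub_cancel, div_pow, le_div_iff₀ (by positivity)] at hb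
    calc _ = w x * ((1 + m * (t x / c - 1)) * c ^ m) := by ring
      _ ≤ _ := mul_le_mul_of_nonneg_left hb (hw x)
  have := integral_mono ((hwi.const_mul (c ^ m * (1 - m))).add (hwt.const_mul (c ^ m * m / c)))
    hwtm hpt
  simp only [Pi.add_apply] at this
  rw [integral_add (hwi.const_mul _) (hwt.const_mul _), integral_const_mul, integral_const_mul,
    hw1] at this
  refine le_trans (le_of_eq ?_) this
  change c ^ m = c ^ m * (1 - m) * 1 + c ^ m * m / c * c
  field_simp
  ring

lemma integrable_norm_pow_mul_exp {n : ℕ} (hn : 0 < n) (d : ℕ) :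
    Integrable (fun x : EuclideanSpace ℝ (Fin n) =>
      ‖x‖ ^ d * Real.exp (-(1 / 2) * ‖x‖ ^ 2)) := by
  have : Nonempty (Fin n) := ⟨⟨0, hn⟩⟩
  refine (integrable_fun_norm_addHaar volume
    (f := fun r => r ^ d * Real.exp (-(1 / 2) * r ^ 2))).2 ?_
  simp only [smul_eq_mul, ← mul_assoc, ← pow_add]
  exact (integrable_pow_mul_exp_neg_half_sq _).integrableOn

lemma integral_norm_pow_mul_exp_pos {n : ℕ} (hn : 0 < n) (d : ℕ) :
    0 < ∫ x : EuclideanSpace ℝ (Fin n), ‖x‖ ^ d * Real.exp (-(1 / 2) * ‖x‖ ^ 2) := by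
  have : Nonempty (Fin n) := ⟨⟨0, hn⟩⟩
  rw [integral_pos_iff_support_of_nonneg (fun x => by positivity) (integrable_norm_pow_mul_exp hn d)]
  refine lt_of_lt_of_le (isOpen_compl_singleton.measure_pos volume
    (exists_ne (0 : EuclideanSpace ℝ (Fin n)))) (measure_mono fun x hx => ?_)
  have : 0 < ‖x‖ := norm_pos_iff.2 hx
  exact (by positivity : 0 < ‖x‖ ^ d * Real.exp (-(1 / 2) * ‖x‖ ^ 2)).ne'

/-- A reverse Hölder inequality for homogeneous polynomials on the sphere. -/
lemma integral_uSphere_eval_pow_le {n k m : ℕ} (hn : 0 < n) (hm : 1 ≤ m)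
    {P : MvPolynomial (Fin n) ℝ} (hP : P.IsHomogeneous k) :
    ∫ x, MvPolynomial.eval (fun i => (x : EuclideanSpace ℝ (Fin n)) i) P ^ (2 * m) ∂uSphere n ≤
      ((2 * m - 1 : ℝ) ^ k *
        ∫ x, MvPolynomial.eval (fun i => (x : EuclideanSpace ℝ (Fin n)) i) P ^ 2 ∂uSphere n) ^ m := by
  have hK : (0 : ℝ) ≤ 2 * m - 1 := by
    have : (1 : ℝ) ≤ m := by exact_mod_cast hm
    linarith
  set Z : ℝ := √(2 * Real.pi) ^ n
  have hZ : 0 < Z := by positivity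
  set R : ℕ → ℝ := fun d =>
    ∫ x : EuclideanSpace ℝ (Fin n), ‖x‖ ^ d * Real.exp (-(1 / 2) * ‖x‖ ^ 2)
  have hR0 : R 0 = Z := by
    have h := integral_eval_mul_exp_neg_half_norm_sq (1 : MvPolynomial (Fin n) ℝ)
    have hone : gaussExpect (1 : MvPolynomial (Fin n) ℝ) = 1 := by
      simp [gaussExpect, MvPolynomial.support_one, gaussMoment]
    rw [hone, mul_one] at h
    simpa only [R, map_one, one_mul, pow_zero] using h
  have hpolar {d : ℕ} {Q : MvPolynomial (Fin n) ℝ} (hQ : Q.IsHomogeneous d) :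
      gaussExpect Q =
        (∫ x, MvPolynomial.eval (fun i => (x : EuclideanSpace ℝ (Fin n)) i) Q ∂uSphere n) *
          (R d / Z) := by
    have := integral_eval_mul_exp_neg_half_norm_sq Q
    rw [integral_eval_mul_exp_eq_integral_uSphere_mul hn hQ] at this
    rw [← mul_div_assoc, eq_div_iff hZ.ne', mul_comm, ← this]
  have hjensen : (R (k * 2) / Z) ^ m ≤ R (k * (2 * m)) / Z := by
    have hint (d : ℕ) : Integrable (fun x : EuclideanSpace ℝ (Fin n) =>
        Real.exp (-(1 / 2) * ‖x‖ ^ 2) / Z * ‖x‖ ^ d) := by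
      convert (integrable_norm_pow_mul_exp hn d).div_const Z using 2
      ring
    have hval (d : ℕ) : ∫ x : EuclideanSpace ℝ (Fin n),
        Real.exp (-(1 / 2) * ‖x‖ ^ 2) / Z * ‖x‖ ^ d = R d / Z := by
      rw [← integral_div]
      congr 1; ext x; ring
    have hw1 := hval 0
    simp only [pow_zero, mul_one] at hw1
    rw [hR0, div_self hZ.ne'] at hw1
    have h := pow_integral_mul_le_integral_mul_pow m (μ := volume)
      (w := fun x : EuclideanSpace ℝ (Fin n) => Real.exp (-(1 / 2) * ‖x‖ ^ 2) / Z)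
      (t := fun x => ‖x‖ ^ (k * 2)) (fun x => by positivity) (fun x => by positivity) hw1
      (hint _) (by simpa only [← pow_mul] using hint (k * 2 * m))
    simp only [← pow_mul, hval] at h
    rwa [mul_assoc] at h
  have hg := gaussExpect_pow_le hm hP
  rw [hpolar (hP.pow (2 * m)), hpolar (hP.pow 2)] at hg
  simp only [map_pow] at hg
  have hRpos : 0 < R (k * (2 * m)) / Z := div_pos (integral_norm_pow_mul_exp_pos hn _) hZ
  refine le_of_mul_le_mul_right (hg.trans ?_) hRpos
  rw [← mul_assoc, mul_pow _ (R (k * 2) / Z)]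
  refine mul_le_mul_of_nonneg_left hjensen (pow_nonneg (mul_nonneg (pow_nonneg hK _) ?_) _)
  exact integral_nonneg fun x => by positivity

/-- The choice of an even exponent for the hypercontractive inequality. -/
lemma exists_two_mul_sub_one_mul_exp_le (L : ℝ) :
    ∃ m : ℕ, 1 ≤ m ∧ (2 * m - 1 : ℝ) * Real.exp (L / (2 * m)) ≤ Real.exp 1 * max 1 L := by
  rcases le_or_gt L 2 with hL | hL
  · refine ⟨1, le_rfl, ?_⟩
    calc _ = Real.exp (L / 2) * 1 := by norm_num
      _ ≤ _ := by
        gcongr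
        · linarith
        · exact le_max_left _ _
  · set m := ⌈L / 2⌉₊
    have h1 : L / 2 ≤ m := Nat.le_ceil _
    have h2 : (m : ℝ) < L / 2 + 1 := Nat.ceil_lt_add_one (by linarith)
    have hm : 2 ≤ m := by
      have : (1 : ℝ) < m := by linarith
      exact_mod_cast this
    have hm' : (2 : ℝ) ≤ m := by exact_mod_cast hm
    refine ⟨m, by omega, ?_⟩
    rw [max_eq_right (by linarith)]
    set t := 1 - L / (2 * m) with ht
    have hLt : L = 2 * m * (1 - t) := by rw [ht]; field_simp; ring
    have ht0 : 0 ≤ t := by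
      rw [ht, sub_nonneg, div_le_one (by positivity)]; linarith
    have htm : m * t < 1 := by
      have : m * t = m - L / 2 := by rw [ht]; field_simp
      linarith
    have hexp : Real.exp (L / (2 * m)) * (1 + t) ≤ Real.exp 1 := by
      have : Real.exp (L / (2 * m)) * Real.exp t = Real.exp 1 := by
        rw [← Real.exp_add, ht, add_sub_cancel]
      rw [← this]
      gcongr
      linarith [Real.add_one_le_exp t]
    have hkey : 2 * (m : ℝ) - 1 ≤ L * (1 + t) := by
      have : 2 * (m * t) * t ≤ 1 := by nlinarith
      rw [hLt]; nlinarith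
    have hLe : 0 ≤ L * Real.exp (L / (2 * m)) := by positivity
    calc _ ≤ L * (1 + t) * Real.exp (L / (2 * m)) := by gcongr
      _ = (Real.exp (L / (2 * m)) * (1 + t)) * L := by ring
      _ ≤ _ := by gcongr

open MvPolynomial in
/-- KKL-type bound on spherical-harmonic projections: if `f : S^{n-1} → ℝ` has
`‖f‖₁ = 1` and `‖f‖_∞ ≤ M`, then `‖Proj_{𝒮ₖ} f‖₂ ≤ (e·max(1, log M/(λₖ/(2n-2))))^{λₖ/(2n-2)}`
with `λₖ = k(k+n-2)`.  The projection norm is expressed dually: for every spherical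
harmonic `φ` of degree `k` (the restriction to the sphere of a harmonic homogeneous
polynomial `P` of degree `k`) with `‖φ‖₂ ≤ 1`, the inner product `⟨f, φ⟩` is at most
the stated bound. -/
theorem spherical_projection_bound (n : ℕ) (hn : 2 ≤ n)
    (f : sphere (0 : EuclideanSpace ℝ (Fin n)) 1 → ℝ) (hfm : Measurable f)
    (M : ℝ) (hM : 1 ≤ M)
    (hf1 : ∫ x, |f x| ∂uSphere n = 1) (hfM : ∀ x, |f x| ≤ M)
    (k : ℕ) (hk : 1 ≤ k) (P : MvPolynomial (Fin n) ℝ)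
    (hhom : P.IsHomogeneous k)
    (hharm : ∑ i : Fin n, MvPolynomial.pderiv i (MvPolynomial.pderiv i P) = 0)
    (hnorm : ∫ x, (MvPolynomial.eval (fun i => (x : EuclideanSpace ℝ (Fin n)) i) P) ^ 2
        ∂uSphere n ≤ 1) :
    |∫ x, f x * MvPolynomial.eval (fun i => (x : EuclideanSpace ℝ (Fin n)) i) P ∂uSphere n|
      ≤ (Real.exp 1 *
          max 1 (Real.log M / (((k : ℝ) * (k + n - 2)) / (2 * n - 2)))) ^
            (((k : ℝ) * (k + n - 2)) / (2 * n - 2)) := by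
  have hn' : (2 : ℝ) ≤ n := by exact_mod_cast hn
  have hk' : (1 : ℝ) ≤ k := by exact_mod_cast hk
  have := isProbabilityMeasure_uSphere (show 0 < n by omega)
  set a : ℝ := ((k : ℝ) * (k + n - 2)) / (2 * n - 2) with ha
  have hka : (k : ℝ) ≤ 2 * a := by
    rw [ha, ← mul_div_assoc, le_div_iff₀ (by linarith)]
    nlinarith
  have ha0 : 0 < a := by linarith
  set L := Real.log M / a with hL
  have hML : M = Real.exp (a * L) := by
    rw [hL, mul_div_cancel₀ _ ha0.ne', Real.exp_log (by linarith)]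
  obtain ⟨m, hm, hmL⟩ := exists_two_mul_sub_one_mul_exp_le L
  have hm' : (1 : ℝ) ≤ m := by exact_mod_cast hm
  set p : sphere (0 : EuclideanSpace ℝ (Fin n)) 1 → ℝ :=
    fun x => MvPolynomial.eval (fun i => (x : EuclideanSpace ℝ (Fin n)) i) P with hp
  have hpc : Continuous p := by
    refine (MvPolynomial.continuous_eval P).comp ?_
    fun_prop
  have hint (g : sphere (0 : EuclideanSpace ℝ (Fin n)) 1 → ℝ) (hg : Continuous g) :
      Integrable g (uSphere n) := by
    obtain ⟨C, hC⟩ := isCompact_univ.exists_bound_of_continuousOn hg.continuousOn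
    exact .of_bound hg.aestronglyMeasurable C (.of_forall fun x => hC x trivial)
  have hfint (g : sphere (0 : EuclideanSpace ℝ (Fin n)) 1 → ℝ) (hg : Continuous g) :
      Integrable (fun x => |f x| * g x) (uSphere n) :=
    (hint g hg).bdd_mul hfm.abs.aestronglyMeasurable (c := M)
      (.of_forall fun x => by simpa using hfM x)
  have hmoment : (∫ x, |f x| * |p x| ∂uSphere n) ^ (2 * m) ≤ M * ((2 * m - 1 : ℝ) ^ k) ^ m := by
    calc _ ≤ ∫ x, |f x| * |p x| ^ (2 * m) ∂uSphere n :=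
          pow_integral_mul_le_integral_mul_pow _ (fun x => abs_nonneg _) (fun x => abs_nonneg _)
            hf1 (hfint _ (by fun_prop)) (hfint _ (by fun_prop))
      _ ≤ ∫ x, M * p x ^ (2 * m) ∂uSphere n := by
          refine integral_mono (hfint _ (by fun_prop)) (hint _ (by fun_prop)) fun x => ?_
          simp only [Even.pow_abs (even_two_mul m)]
          exact mul_le_mul_of_nonneg_right (hfM x) ((even_two_mul m).pow_nonneg _)
      _ = M * ∫ x, p x ^ (2 * m) ∂uSphere n := integral_const_mul _ _
      _ ≤ M * ((2 * m - 1 : ℝ) ^ k * ∫ x, p x ^ 2 ∂uSphere n) ^ m := by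
          gcongr
          exact integral_uSphere_eval_pow_le (by omega) hm hhom
      _ ≤ M * ((2 * m - 1 : ℝ) ^ k) ^ m := by
          have hK : (0 : ℝ) ≤ (2 * m - 1 : ℝ) ^ k := pow_nonneg (by linarith) _
          have hs : 0 ≤ ∫ x, p x ^ 2 ∂uSphere n := integral_nonneg fun x => sq_nonneg _
          gcongr
          exact mul_le_of_le_one_right hK hnorm
  have hbound : M * ((2 * m - 1 : ℝ) ^ k) ^ m ≤ ((Real.exp 1 * max 1 L) ^ a) ^ (2 * m) := by
    have hK : (1 : ℝ) ≤ 2 * m - 1 := by linarith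
    have h1 : ((2 * m - 1 : ℝ) ^ k) ^ m ≤ (2 * m - 1 : ℝ) ^ (a * (2 * m)) := by
      rw [← pow_mul, ← Real.rpow_natCast]
      refine Real.rpow_le_rpow_of_exponent_le hK ?_
      push_cast
      nlinarith
    have h2 : M = Real.exp (L / (2 * m)) ^ (a * (2 * m)) := by
      rw [hML, ← Real.exp_mul]
      congr 1
      field_simp
    rw [← Real.rpow_natCast (_ ^ a), ← Real.rpow_mul (by positivity)]
    push_cast
    calc _ ≤ M * (2 * m - 1 : ℝ) ^ (a * (2 * m)) := by gcongr
      _ = ((2 * m - 1 : ℝ) * Real.exp (L / (2 * m))) ^ (a * (2 * m)) := by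
          rw [Real.mul_rpow (by linarith) (by positivity), ← h2, mul_comm]
      _ ≤ _ := Real.rpow_le_rpow (mul_nonneg (by linarith) (by positivity)) hmL (by positivity)
  calc |∫ x, f x * p x ∂uSphere n| ≤ ∫ x, |f x * p x| ∂uSphere n := abs_integral_le_integral_abs
    _ = ∫ x, |f x| * |p x| ∂uSphere n := by simp only [abs_mul]
    _ ≤ _ := le_of_pow_le_pow_left₀ (by omega) (by positivity) (hmoment.trans hbound)
end
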